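/- A nonnegative integrable random variable W follows the Dickman law if and only if for every continuously differentiable function f : ℝ → ℝ with bounded derivative, E[W·f′(W) − f(W + 1) + f(W)] = 0. -/

import Mathlib

open Real MeasureTheory ProbabilityTheory

theorem affine_le_exp {A B x : ℝ} (hA : 0 ≤ A) (hB : 0 ≤ B) (hx : 0 < x) :
    A + B * x ≤ (A + 2 * B) * exp (1 / 2 * x) := by
  have h1 : 1 / 2 * x + 1 ≤ exp (1 / 2 * x) := add_one_le_exp _
  nlinarith

theorem abs_le_affine {f f' : ℝ → ℝ} (hf : ∀ x, HasDerivAt f (f' x) x) {M : ℝ}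
    (hM : ∀ x, 0 ≤ x → |f' x| ≤ M) {x : ℝ} (hx : 0 ≤ x) : |f x| ≤ |f 0| + M * x := by
  have := (convex_Ici (0 : ℝ)).norm_image_sub_le_of_norm_hasDerivWithin_le
    (fun y _ => (hf y).hasDerivWithinAt) (fun y hy => hM y hy) Set.self_mem_Ici hx
  rw [sub_zero, norm_eq_abs, norm_of_nonneg hx] at this
  have h2 := abs_sub_abs_le_abs_sub (f x) (f 0)
  linarith

/-- The Dickman function, extended by the value `1` to the negative half-line. -/
structure IsDickman (r : ℝ → ℝ) : Prop where
  continuous : Continuous r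
  eq_one : ∀ u ≤ 1, r u = 1
  hasDerivAt : ∀ u, 1 < u → HasDerivAt r (-r (u - 1) / u) u

namespace IsDickman

open Set Filter Topology

variable {r : ℝ → ℝ}

theorem hasDerivAt_mul_self (hr : IsDickman r) {u : ℝ} (hu : 1 < u) :
    HasDerivAt (fun x => x * r x) (r u - r (u - 1)) u := by
  refine ((hasDerivAt_id u).mul (hr.hasDerivAt u hu)).congr_deriv ?_
  have : u ≠ 0 := by positivity
  simp only [id]
  field_simp
  ring

theorem mul_self_eq_integral (hr : IsDickman r) {u : ℝ} (hu : 1 ≤ u) :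
    u * r u = ∫ t in (u - 1)..u, r t := by
  have hii (a b : ℝ) : IntervalIntegrable r volume a b := hr.continuous.intervalIntegrable a b
  have hP (x : ℝ) : HasDerivAt (fun y => ∫ t in (0 : ℝ)..y, r t) (r x) x :=
    intervalIntegral.integral_hasDerivAt_right (hii _ _)
      hr.continuous.stronglyMeasurable.stronglyMeasurableAtFilter hr.continuous.continuousAt
  set P : ℝ → ℝ := fun y => ∫ t in (0 : ℝ)..y, r t with hPdef
  have hPc : Continuous P := continuous_iff_continuousAt.2 fun x => (hP x).continuousAt
  have hsub (x : ℝ) : ∫ t in (x - 1)..x, r t = P x - P (x - 1) :=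
    (intervalIntegral.integral_interval_sub_left (hii _ _) (hii _ _)).symm
  have h_one : ∫ t in ((1 : ℝ) - 1)..1, r t = 1 := by
    have : ∫ t in ((1 : ℝ) - 1)..1, r t = ∫ t in ((1 : ℝ) - 1)..1, (1 : ℝ) := by
      refine intervalIntegral.integral_congr fun x hx => hr.eq_one x ?_
      rw [uIcc_of_le (by norm_num)] at hx
      exact hx.2
    rw [this]
    simp
  rw [hsub] at h_one ⊢
  rcases hu.eq_or_lt with rfl | hu
  · rw [h_one, hr.eq_one 1 le_rfl, one_mul]
  obtain ⟨c, hc, hc'⟩ := exists_hasDerivAt_eq_slope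
    (fun x => x * r x - (P x - P (x - 1))) (fun _ => 0) hu
    (by have := hr.continuous; fun_prop)
    (fun x hx => (((hr.hasDerivAt_mul_self hx.1).sub ((hP x).sub
      ((hP (x - 1)).comp_sub_const x 1))).congr_deriv (by ring)))
  rw [eq_div_iff (by linarith)] at hc'
  have := hr.eq_one 1 le_rfl
  simp only [this] at hc'
  linarith

theorem pos (hr : IsDickman r) (u : ℝ) : 0 < r u := by
  by_contra! hu
  set S := {x | r x ≤ 0}
  have hS : IsClosed S := isClosed_le hr.continuous continuous_const
  have h1 : ∀ x ∈ S, 1 < x := by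
    intro x hx
    by_contra! h
    have := hr.eq_one x h
    simp only [S, mem_ofPred_eq] at hx
    linarith
  have hb : BddBelow S := ⟨1, fun x hx => (h1 x hx).le⟩
  have hm := hS.csInf_mem ⟨u, hu⟩ hb
  set m := sInf S
  have hm1 := h1 m hm
  have hlt : ∀ x < m, 0 < r x := fun x hx => by
    by_contra! h
    exact absurd (csInf_le hb h) (not_le.2 hx)
  have hpos : 0 < ∫ t in (m - 1)..m, r t :=
    intervalIntegral.intervalIntegral_pos_of_pos_on (hr.continuous.intervalIntegrable _ _)
      (fun x hx => hlt x hx.2) (by linarith)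
  rw [← hr.mul_self_eq_integral hm1.le] at hpos
  have : r m ≤ 0 := hm
  nlinarith

theorem antitone (hr : IsDickman r) : Antitone r := by
  refine AntitoneOn.Iic_union_Ici (a := 1) ?_ ?_
  · intro x hx y hy _
    rw [hr.eq_one x hx, hr.eq_one y hy]
  · refine antitoneOn_of_hasDerivWithinAt_nonpos (convex_Ici 1) hr.continuous.continuousOn
      (f' := fun u => -r (u - 1) / u) ?_ ?_
    · intro x hx
      rw [interior_Ici] at hx
      exact (hr.hasDerivAt x hx).hasDerivWithinAt
    · intro x hx
      rw [interior_Ici] at hx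
      have hx' : (1 : ℝ) < x := hx
      exact div_nonpos_of_nonpos_of_nonneg (neg_nonpos.2 (hr.pos _).le) (by linarith)

theorem le_one (hr : IsDickman r) (u : ℝ) : r u ≤ 1 := by
  rcases le_total u 1 with h | h
  · exact (hr.eq_one u h).le
  · exact (hr.antitone h).trans_eq (hr.eq_one 1 le_rfl)

theorem mul_self_le (hr : IsDickman r) {u : ℝ} (hu : 1 ≤ u) : u * r u ≤ r (u - 1) := by
  rw [hr.mul_self_eq_integral hu]
  calc ∫ t in (u - 1)..u, r t ≤ ∫ t in (u - 1)..u, r (u - 1) :=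
        intervalIntegral.integral_mono_on (by linarith) (hr.continuous.intervalIntegrable _ _)
          (by simp) fun x hx => hr.antitone hx.1
    _ = r (u - 1) := by simp

theorem le_exp (hr : IsDickman r) (u : ℝ) : r u ≤ exp (3 - u) := by
  obtain ⟨n, hn⟩ := exists_nat_ge (u - 3)
  induction n generalizing u with
  | zero =>
    exact (hr.le_one u).trans (one_le_exp (by simp at hn; linarith))
  | succ n ih =>
    rcases le_total u 3 with h3 | h3
    · exact (hr.le_one u).trans (one_le_exp (by linarith))
    have h1 := ih (u - 1) (by push_cast at hn; linarith)
    have h2 := hr.mul_self_le (by linarith : 1 ≤ u)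
    have h4 : exp (3 - (u - 1)) = exp 1 * exp (3 - u) := by rw [← exp_add]; ring_nf
    have h5 := exp_one_lt_d9
    have h6 := exp_pos (3 - u)
    have h7 := hr.pos u
    nlinarith

theorem integrableOn_mul (hr : IsDickman r) {g : ℝ → ℝ} (hg : Continuous g) {C b : ℝ} (hb : b < 1)
    (hgb : ∀ x, 0 < x → |g x| ≤ C * exp (b * x)) : IntegrableOn (fun x => r x * g x) (Ioi 0) := by
  have hexp : IntegrableOn (fun x => C * exp 3 * exp ((b - 1) * x)) (Ioi 0) :=
    (integrableOn_exp_mul_Ioi (by linarith) 0).const_mul _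
  refine hexp.mono' (hr.continuous.mul hg).aestronglyMeasurable ?_
  refine (ae_restrict_iff' measurableSet_Ioi).2 (.of_forall fun x hx => ?_)
  rw [norm_mul, norm_of_nonneg (hr.pos x).le, norm_eq_abs]
  calc r x * |g x| ≤ exp (3 - x) * (C * exp (b * x)) :=
        mul_le_mul (hr.le_exp x) (hgb x hx) (abs_nonneg _) (exp_pos _).le
    _ = C * (exp (3 - x) * exp (b * x)) := by ring
    _ = C * (exp 3 * exp ((b - 1) * x)) := by rw [← exp_add, ← exp_add]; ring_nf
    _ = _ := by ring

theorem integrableOn_mul_of_affine_bound (hr : IsDickman r) {g : ℝ → ℝ} (hg : Continuous g)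
    {A B : ℝ} (hA : 0 ≤ A) (hB : 0 ≤ B) (hgb : ∀ x, 0 < x → |g x| ≤ A + B * x) :
    IntegrableOn (fun x => r x * g x) (Ioi 0) :=
  hr.integrableOn_mul hg (by norm_num : (1 / 2 : ℝ) < 1)
    fun x hx => (hgb x hx).trans (affine_le_exp hA hB hx)

theorem tendsto_mul_zero_of_affine_bound (hr : IsDickman r) {g : ℝ → ℝ}
    {A B : ℝ} (hA : 0 ≤ A) (hB : 0 ≤ B) (hgb : ∀ x, 0 < x → |g x| ≤ A + B * x) :
    Tendsto (fun x => x * r x * g x) atTop (𝓝 0) := by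
  have hlim : Tendsto (fun x : ℝ => (A + 2 * B) * exp 3 * (x ^ (1 : ℝ) * exp (-(1 / 2) * x)))
      atTop (𝓝 0) := by
    simpa using (tendsto_rpow_mul_exp_neg_mul_atTop_nhds_zero 1 (1 / 2) (by norm_num)).const_mul
      ((A + 2 * B) * exp 3)
  refine squeeze_zero_norm' ?_ hlim
  filter_upwards [eventually_gt_atTop 0] with x hx
  rw [norm_mul, norm_mul, norm_of_nonneg (hr.pos x).le, norm_of_nonneg hx.le, norm_eq_abs, rpow_one]
  calc x * r x * |g x| ≤ x * exp (3 - x) * ((A + 2 * B) * exp (1 / 2 * x)) :=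
        mul_le_mul (mul_le_mul_of_nonneg_left (hr.le_exp x) hx.le)
          ((hgb x hx).trans (affine_le_exp hA hB hx)) (abs_nonneg _) (by positivity)
    _ = (A + 2 * B) * (x * (exp (3 - x) * exp (1 / 2 * x))) := by ring
    _ = (A + 2 * B) * (x * (exp 3 * exp (-(1 / 2) * x))) := by
        rw [← exp_add, ← exp_add]; ring_nf
    _ = _ := by ring

/-- The Stein identity for the Dickman function. -/
theorem integral_stein (hr : IsDickman r) {f f' : ℝ → ℝ} (hf : ∀ x, HasDerivAt f (f' x) x)
    (hf' : Continuous f') {M : ℝ} (hM : ∀ x, 0 ≤ x → |f' x| ≤ M) :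
    IntegrableOn (fun x => r x * (x * f' x)) (Ioi 0) ∧ IntegrableOn (fun x => r x * f x) (Ioi 0) ∧
    IntegrableOn (fun x => r x * f (x + 1)) (Ioi 0) ∧
    (∫ x in Ioi 0, r x * (x * f' x)) - (∫ x in Ioi 0, r x * f (x + 1))
      + ∫ x in Ioi 0, r x * f x = 0 := by
  have hfc : Continuous f := continuous_iff_continuousAt.2 fun x => (hf x).continuousAt
  have hM0 : 0 ≤ M := (abs_nonneg _).trans (hM 0 le_rfl)
  have hfb (x : ℝ) (hx : 0 ≤ x) := abs_le_affine hf hM hx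
  have i1 : IntegrableOn (fun x => r x * (x * f' x)) (Ioi 0) := by
    refine hr.integrableOn_mul_of_affine_bound (by fun_prop) le_rfl hM0 fun x hx => ?_
    rw [abs_mul, abs_of_pos hx, zero_add, mul_comm]
    exact mul_le_mul_of_nonneg_right (hM x hx.le) hx.le
  have i2 : IntegrableOn (fun x => r x * f x) (Ioi 0) :=
    hr.integrableOn_mul_of_affine_bound hfc (abs_nonneg (f 0)) hM0 fun x hx => hfb x hx.le
  have i3 : IntegrableOn (fun x => r x * f (x + 1)) (Ioi 0) := by
    refine hr.integrableOn_mul_of_affine_bound (A := |f 0| + M) (by fun_prop) (by positivity) hM0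
      fun x hx => (hfb (x + 1) (by linarith)).trans_eq (by ring)
  refine ⟨i1, i2, i3, ?_⟩
  have hmp : MeasurePreserving (fun x : ℝ => x + 1) := measurePreserving_add_right volume 1
  have hme : MeasurableEmbedding (fun x : ℝ => x + 1) := measurableEmbedding_addRight 1
  have hpre : (fun x : ℝ => x + 1) ⁻¹' Ioi 1 = Ioi 0 := by simp
  have hshift : ∫ x in Ioi 0, r x * f (x + 1) = ∫ x in Ioi 1, r (x - 1) * f x := by
    simpa [hpre] using hmp.setIntegral_preimage_emb hme (fun x => r (x - 1) * f x) (Ioi 1)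
  have i3' : IntegrableOn (fun x => r (x - 1) * f x) (Ioi 1) := by
    refine (hmp.integrableOn_comp_preimage hme).1 ?_
    simpa only [hpre, Function.comp_def, add_sub_cancel_right] using i3
  have hsum : IntegrableOn (fun x => r x * (x * f' x) + r x * f x) (Ioi 0) := i1.add i2
  have hI1 : ∫ x in (0 : ℝ)..1, (r x * (x * f' x) + r x * f x) = f 1 := by
    have h1 : ∫ x in (0 : ℝ)..1, (r x * (x * f' x) + r x * f x)
        = ∫ x in (0 : ℝ)..1, (f x + x * f' x) := by
      refine intervalIntegral.integral_congr fun x hx => ?_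
      rw [uIcc_of_le zero_le_one] at hx
      simp only [hr.eq_one x hx.2]
      ring
    rw [h1, intervalIntegral.integral_eq_sub_of_hasDerivAt (f := fun x => x * f x)
      (fun x _ => ((hasDerivAt_id x).mul (hf x)).congr_deriv (by simp))
      ((by fun_prop : Continuous fun x => f x + x * f' x).intervalIntegrable _ _)]
    simp
  have hI2 : ∫ x in Ioi 1, (r x * (x * f' x) + r x * f x - r (x - 1) * f x) = 0 - f 1 := by
    have hc := hr.continuous
    have i4 : IntegrableOn (fun x => r x * (x * f' x) + r x * f x - r (x - 1) * f x) (Ioi 1) :=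
      (hsum.mono_set (Ioi_subset_Ioi zero_le_one)).sub i3'
    rw [integral_Ioi_of_hasDerivAt_of_tendsto (f := fun x => x * r x * f x) (m := 0) (a := 1)
      (by fun_prop : Continuous fun x => x * r x * f x).continuousWithinAt
      (fun x hx => ((hr.hasDerivAt_mul_self hx).mul (hf x)).congr_deriv (by ring))
      i4 (hr.tendsto_mul_zero_of_affine_bound (abs_nonneg _) hM0 fun x hx => hfb x hx.le)]
    simp [hr.eq_one 1 le_rfl]
  rw [integral_sub (hsum.mono_set (Ioi_subset_Ioi zero_le_one)) i3'] at hI2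
  have hsplit := intervalIntegral.integral_interval_add_Ioi hsum
    (hsum.mono_set (Ioi_subset_Ioi zero_le_one))
  rw [integral_add i1 i2] at hsplit
  rw [hshift]
  linarith

end IsDickman

section Laplace

open Set Filter Topology

theorem integrableOn_log_mul_exp_neg : IntegrableOn (fun t => log t * exp (-t)) (Ioi 0) := by
  rw [← Ioc_union_Ioi_eq_Ioi (zero_le_one (α := ℝ))]
  refine IntegrableOn.union ?_ ?_
  · rw [← intervalIntegrable_iff_integrableOn_Ioc_of_le zero_le_one]
    exact intervalIntegral.intervalIntegrable_log'.mul_continuousOn (by fun_prop)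
  · have hexp : IntegrableOn (fun x : ℝ => 2 * exp (-(1 / 2) * x)) (Ioi 1) :=
      (integrableOn_exp_mul_Ioi (by norm_num) 1).const_mul _
    refine hexp.mono' (by fun_prop) ?_
    refine (ae_restrict_iff' measurableSet_Ioi).2 (.of_forall fun x hx => ?_)
    have hx1 : (1 : ℝ) < x := hx
    rw [norm_mul, norm_of_nonneg (log_nonneg hx1.le), norm_of_nonneg (exp_pos _).le]
    have h1 : log x ≤ 2 * exp (1 / 2 * x) := by
      have h1 : 1 / 2 * x + 1 ≤ exp (1 / 2 * x) := add_one_le_exp _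
      linarith [log_le_sub_one_of_pos (zero_lt_one.trans hx1)]
    calc log x * exp (-x) ≤ 2 * exp (1 / 2 * x) * exp (-x) := by gcongr
      _ = _ := by rw [mul_assoc, ← exp_add]; ring_nf

theorem integral_log_mul_exp_neg :
    ∫ t in Ioi 0, log t * exp (-t) = -eulerMascheroniConstant := by
  rw [eulerMascheroniConstant_eq_neg_deriv, neg_neg]
  have h1 := Complex.hasDerivAt_GammaIntegral (s := ((1 : ℝ) : ℂ)) (by simp)
  have h2 : Complex.Gamma =ᶠ[𝓝 ((1 : ℝ) : ℂ)] Complex.GammaIntegral := by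
    have : ∀ᶠ s : ℂ in 𝓝 ((1 : ℝ) : ℂ), 0 < s.re :=
      Complex.continuous_re.continuousAt.eventually (lt_mem_nhds (by simp))
    filter_upwards [this] with s hs using Complex.Gamma_eq_integral hs
  have h3 : HasDerivAt Gamma _ 1 := (h1.congr_of_eventuallyEq h2).real_of_complex
  rw [h3.deriv]
  simp only [Complex.ofReal_one, sub_self, Complex.cpow_zero, one_mul, ← Complex.ofReal_mul]
  rw [integral_complex_ofReal, Complex.ofReal_re]

/-- The entire exponential integral `∫₀ˢ (1 - e⁻ᵘ) / u du`, written after an integration by parts. -/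
noncomputable def expIntegralIn (s : ℝ) : ℝ :=
  (1 - exp (-s)) * log s - ∫ u in (0 : ℝ)..s, log u * exp (-u)

theorem intervalIntegrable_log_mul_exp_neg (a b : ℝ) :
    IntervalIntegrable (fun u => log u * exp (-u)) volume a b :=
  intervalIntegral.intervalIntegrable_log'.mul_continuousOn (by fun_prop)

theorem hasDerivAt_expIntegralIn {s : ℝ} (hs : 0 < s) :
    HasDerivAt expIntegralIn ((1 - exp (-s)) / s) s := by
  have h1 : HasDerivAt (fun x => ∫ u in (0 : ℝ)..x, log u * exp (-u)) (log s * exp (-s)) s :=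
    intervalIntegral.integral_hasDerivAt_right (intervalIntegrable_log_mul_exp_neg _ _)
      (by fun_prop : StronglyMeasurable fun u => log u * exp (-u)).stronglyMeasurableAtFilter
      ((continuousAt_log hs.ne').mul (by fun_prop))
  have h2 : HasDerivAt (fun x => 1 - exp (-x)) (exp (-s)) s :=
    (((hasDerivAt_id s).neg.exp).const_sub 1).congr_deriv (by simp)
  exact ((h2.mul (hasDerivAt_log hs.ne')).sub h1).congr_deriv (by field_simp; ring)

theorem tendsto_expIntegralIn_zero : Tendsto expIntegralIn (𝓝[>] 0) (𝓝 0) := by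
  have h1 : Tendsto (fun s => (1 - exp (-s)) * log s) (𝓝[>] 0) (𝓝 0) := by
    have hl := (tendsto_log_mul_rpow_nhdsGT_zero zero_lt_one).abs
    rw [abs_zero] at hl
    refine squeeze_zero_norm' ?_ hl
    filter_upwards [self_mem_nhdsWithin] with s hs
    have hs' : (0 : ℝ) < s := hs
    rw [rpow_one, norm_mul, abs_mul, mul_comm, norm_eq_abs, norm_eq_abs]
    refine mul_le_mul_of_nonneg_left ?_ (abs_nonneg _)
    rw [abs_of_nonneg (by simpa using hs'.le), abs_of_pos hs']
    linarith [add_one_le_exp (-s)]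
  have h2 : Tendsto (fun s => ∫ u in (0 : ℝ)..s, log u * exp (-u)) (𝓝[>] 0) (𝓝 0) := by
    have := (intervalIntegral.continuous_primitive intervalIntegrable_log_mul_exp_neg 0).tendsto 0
    rw [intervalIntegral.integral_same] at this
    exact this.mono_left nhdsWithin_le_nhds
  have h3 := h1.sub h2
  rwa [sub_zero] at h3

theorem tendsto_expIntegralIn_sub_log_atTop :
    Tendsto (fun s => expIntegralIn s - log s) atTop (𝓝 eulerMascheroniConstant) := by
  have h1 : Tendsto (fun s => exp (-s) * log s) atTop (𝓝 0) := by
    refine squeeze_zero_norm' ?_ (tendsto_pow_mul_exp_neg_atTop_nhds_zero 1)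
    filter_upwards [eventually_ge_atTop 1] with s hs
    rw [norm_mul, norm_of_nonneg (exp_pos _).le, norm_of_nonneg (log_nonneg hs), pow_one, mul_comm]
    refine mul_le_mul_of_nonneg_right ?_ (exp_pos _).le
    linarith [log_le_sub_one_of_pos (zero_lt_one.trans_le hs)]
  have h2 := intervalIntegral_tendsto_integral_Ioi 0 integrableOn_log_mul_exp_neg tendsto_id
  rw [integral_log_mul_exp_neg] at h2
  have h3 := h1.neg.sub h2
  rw [neg_zero, sub_neg_eq_add, zero_add] at h3
  refine h3.congr fun s => ?_
  simp only [expIntegralIn, id]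
  ring

end Laplace

namespace IsDickman

open Set Filter Topology

variable {r : ℝ → ℝ}

/-- The measure on the positive half-line with density `c * r`. -/
noncomputable def measure (r : ℝ → ℝ) (c : ℝ) : Measure ℝ :=
  (volume.restrict (Ioi 0)).withDensity fun x => ENNReal.ofReal (c * r x)

theorem integral_measure (hr : IsDickman r) {c : ℝ} (hc : 0 ≤ c) (g : ℝ → ℝ) :
    ∫ x, g x ∂measure r c = c * ∫ x in Ioi 0, r x * g x := by
  have := hr.continuous
  rw [measure, integral_withDensity_eq_integral_toReal_smul (by fun_prop) (by simp),
    ← integral_const_mul]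
  congr 1 with x
  rw [ENNReal.toReal_ofReal (mul_nonneg hc (hr.pos x).le), smul_eq_mul, mul_assoc]

theorem integrable_measure (hr : IsDickman r) {c : ℝ} (hc : 0 ≤ c) {g : ℝ → ℝ}
    (hg : IntegrableOn (fun x => r x * g x) (Ioi 0)) : Integrable g (measure r c) := by
  have := hr.continuous
  rw [measure, integrable_withDensity_iff (by fun_prop) (by simp)]
  refine (hg.const_mul c).congr (.of_forall fun x => ?_)
  simp only [ENNReal.toReal_ofReal (mul_nonneg hc (hr.pos x).le)]
  ring

theorem integrableOn_mul_exp (hr : IsDickman r) {t : ℝ} (ht : t < 1) :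
    IntegrableOn (fun x => r x * exp (t * x)) (Ioi 0) :=
  hr.integrableOn_mul (C := 1) (by fun_prop) ht fun x _ => by rw [abs_of_pos (exp_pos _), one_mul]

theorem hasDerivAt_laplace (hr : IsDickman r) {s : ℝ} (hs : -1 < s) :
    HasDerivAt (fun s => ∫ x in Ioi 0, r x * exp (-s * x))
      (-∫ x in Ioi 0, r x * (x * exp (-s * x))) s := by
  have hsub : Iio 1 ⊆ integrableExpSet id (measure r 1) := fun t ht =>
    hr.integrable_measure zero_le_one (hr.integrableOn_mul_exp ht)
  have hmem : -s ∈ interior (integrableExpSet id (measure r 1)) :=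
    interior_mono hsub (by rw [interior_Iio]; exact neg_lt.1 hs)
  have h := (hasDerivAt_mgf hmem).comp s (hasDerivAt_neg s)
  simp only [hr.integral_measure zero_le_one, id, one_mul, mul_neg, mul_one] at h
  refine h.congr_of_eventuallyEq (.of_forall fun t => ?_)
  simp [mgf, hr.integral_measure zero_le_one]

theorem laplace_stein (hr : IsDickman r) {s : ℝ} (hs : 0 < s) :
    s * ∫ x in Ioi 0, r x * (x * exp (-s * x))
      = (1 - exp (-s)) * ∫ x in Ioi 0, r x * exp (-s * x) := by
  obtain ⟨-, -, -, h⟩ := hr.integral_stein (f := fun x => exp (-s * x))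
    (f' := fun x => -s * exp (-s * x)) (M := s)
    (fun x => (((hasDerivAt_id x).const_mul (-s)).exp).congr_deriv (by simp; ring))
    (by fun_prop) (fun x hx => by
      rw [abs_mul, abs_neg, abs_of_pos hs, abs_of_pos (exp_pos _)]
      exact mul_le_of_le_one_right hs.le (exp_le_one_iff.2 (by nlinarith)))
  have e1 : ∫ x in Ioi 0, r x * (x * (-s * exp (-s * x)))
      = -s * ∫ x in Ioi 0, r x * (x * exp (-s * x)) := by
    rw [← integral_const_mul]
    congr 1 with x
    ring
  have e2 : ∫ x in Ioi 0, r x * exp (-s * (x + 1))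
      = exp (-s) * ∫ x in Ioi 0, r x * exp (-s * x) := by
    rw [← integral_const_mul]
    congr 1 with x
    rw [mul_add, exp_add, mul_one]
    ring
  rw [e1, e2] at h
  linarith

theorem tendsto_mul_laplace_atTop (hr : IsDickman r) :
    Tendsto (fun s => s * ∫ x in Ioi 0, r x * exp (-s * x)) atTop (𝓝 1) := by
  have hlow : Tendsto (fun s : ℝ => 1 - exp (-s)) atTop (𝓝 1) := by
    simpa using (tendsto_exp_neg_atTop_nhds_zero).const_sub 1
  refine tendsto_of_tendsto_of_tendsto_of_le_of_le' hlow tendsto_const_nhds ?_ ?_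
  · filter_upwards [eventually_gt_atTop 0] with s hs
    have h1 : ∫ x in (0 : ℝ)..1, s * exp (-s * x) = 1 - exp (-s) := by
      rw [intervalIntegral.integral_eq_sub_of_hasDerivAt (f := fun x => -exp (-s * x))
        (fun x _ => (((hasDerivAt_id x).const_mul (-s)).exp.neg).congr_deriv (by simp; ring))
        ((by fun_prop : Continuous fun x => s * exp (-s * x)).intervalIntegrable _ _)]
      simp
      ring
    rw [← h1, intervalIntegral.integral_const_mul, intervalIntegral.integral_of_le zero_le_one]
    refine mul_le_mul_of_nonneg_left ?_ hs.le
    calc ∫ x in Ioc 0 1, exp (-s * x) = ∫ x in Ioc 0 1, r x * exp (-s * x) :=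
          setIntegral_congr_fun measurableSet_Ioc fun x hx => by simp [hr.eq_one x hx.2]
      _ ≤ _ := setIntegral_mono_set (hr.integrableOn_mul_exp (by linarith))
          (.of_forall fun x => mul_nonneg (hr.pos x).le (exp_pos _).le)
          Ioc_subset_Ioi_self.eventuallyLE
  · filter_upwards [eventually_gt_atTop 0] with s hs
    have h1 : ∫ x in Ioi 0, r x * exp (-s * x) ≤ ∫ x in Ioi 0, exp (-s * x) :=
      integral_mono (hr.integrableOn_mul_exp (by linarith))
        (integrableOn_exp_mul_Ioi (by linarith) 0)
        fun x => mul_le_of_le_one_left (exp_pos _).le (hr.le_one x)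
    rw [integral_exp_mul_Ioi (by linarith)] at h1
    calc s * ∫ x in Ioi 0, r x * exp (-s * x) ≤ s * (-exp (-s * 0) / -s) :=
          mul_le_mul_of_nonneg_left h1 hs.le
      _ = 1 := by simp; field_simp

theorem integral_eq_exp (hr : IsDickman r) : ∫ x in Ioi 0, r x = exp eulerMascheroniConstant := by
  set L : ℝ → ℝ := fun s => ∫ x in Ioi 0, r x * exp (-s * x) with hL
  set F : ℝ → ℝ := fun s => L s * exp (expIntegralIn s) with hF
  have hFd (s : ℝ) (hs : 0 < s) : HasDerivAt F 0 s := by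
    refine ((hr.hasDerivAt_laplace (by linarith)).mul
      (hasDerivAt_expIntegralIn hs).exp).congr_deriv ?_
    have := hr.laplace_stein hs
    rw [← mul_assoc, mul_right_comm, mul_div_assoc', ← add_mul, mul_comm (∫ x in _, _) (1 - _),
      ← this, mul_div_cancel_left₀ _ hs.ne', neg_add_cancel, zero_mul]
  have hFc (s : ℝ) (hs : 0 < s) : F s = F 1 :=
    (convex_Ioi (0 : ℝ)).is_const_of_fderivWithin_eq_zero
      (fun x hx => (hFd x hx).differentiableAt.differentiableWithinAt)
      (fun x hx => by
        rw [fderivWithin_of_isOpen isOpen_Ioi hx]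
        simpa using (hFd x hx).hasFDerivAt.fderiv) hs (mem_Ioi.2 one_pos)
  have h0 : Tendsto F (𝓝[>] 0) (𝓝 (∫ x in Ioi 0, r x)) := by
    have h1 : Tendsto L (𝓝[>] 0) (𝓝 (L 0)) :=
      (hr.hasDerivAt_laplace (by norm_num)).continuousAt.tendsto.mono_left nhdsWithin_le_nhds
    have h2 := h1.mul tendsto_expIntegralIn_zero.rexp
    have h3 : L 0 = ∫ x in Ioi 0, r x := by simp [hL]
    rwa [h3, exp_zero, mul_one] at h2
  have h1 : Tendsto F atTop (𝓝 (exp eulerMascheroniConstant)) := by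
    have := hr.tendsto_mul_laplace_atTop.mul tendsto_expIntegralIn_sub_log_atTop.rexp
    rw [one_mul] at this
    refine this.congr' ?_
    filter_upwards [eventually_gt_atTop 0] with s hs
    rw [exp_sub, exp_log hs]
    simp only [hF, hL]
    field_simp
  have e0 := tendsto_nhds_unique h0 (tendsto_const_nhds.congr' (by
    filter_upwards [self_mem_nhdsWithin] with s hs using (hFc s hs).symm))
  have e1 := tendsto_nhds_unique h1 (tendsto_const_nhds.congr' (by
    filter_upwards [eventually_gt_atTop 0] with s hs using (hFc s hs).symm))
  rw [e0, e1]

theorem isProbabilityMeasure_measure (hr : IsDickman r) :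
    IsProbabilityMeasure (measure r (exp (-eulerMascheroniConstant))) := by
  have hint : IntegrableOn r (Ioi 0) := by simpa using hr.integrableOn_mul_exp zero_lt_one
  constructor
  rw [measure, withDensity_apply _ MeasurableSet.univ, Measure.restrict_univ,
    ← ofReal_integral_eq_lintegral_ofReal (hint.const_mul _)
      (.of_forall fun x => mul_nonneg (exp_pos _).le (hr.pos x).le),
    integral_const_mul, hr.integral_eq_exp, ← exp_add]
  simp

theorem integrable_id_measure (hr : IsDickman r) {c : ℝ} (hc : 0 ≤ c) :
    Integrable (fun x => x) (measure r c) :=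
  hr.integrable_measure hc <| hr.integrableOn_mul_of_affine_bound continuous_id le_rfl zero_le_one
    fun x hx => by simp [abs_of_pos hx]

theorem integral_stein_measure (hr : IsDickman r) {c : ℝ} (hc : 0 ≤ c) {f : ℝ → ℝ}
    (hf : ContDiff ℝ 1 f) (hM : ∃ M : ℝ, ∀ x : ℝ, |deriv f x| ≤ M) :
    ∫ x, (x * deriv f x - f (x + 1) + f x) ∂measure r c = 0 := by
  obtain ⟨M, hM⟩ := hM
  obtain ⟨i1, i2, i3, h⟩ := hr.integral_stein
    (fun x => (hf.differentiable one_ne_zero x).hasDerivAt)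
    (hf.continuous_deriv le_rfl) (fun x _ => hM x)
  rw [hr.integral_measure hc]
  simp only [mul_add, mul_sub]
  have i4 : IntegrableOn (fun x => r x * (x * deriv f x) - r x * f (x + 1)) (Ioi 0) := i1.sub i3
  rw [integral_add i4 i2, integral_sub i1 i3, h, mul_zero]

end IsDickman

section Uniqueness

open Set Filter Topology

/-- The multiplier in the linear differential equation satisfied by the characteristic function of
the Dickman law. -/
noncomputable def dickmanMultiplier (t : ℝ) : ℂ :=
  if t = 0 then Complex.I else (Complex.exp (Complex.I * t) - 1) / t

theorem norm_dickmanMultiplier_le (t : ℝ) : ‖dickmanMultiplier t‖ ≤ 1 := by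
  unfold dickmanMultiplier
  split_ifs with h
  · simp
  · rw [norm_div, Complex.norm_real]
    exact div_le_one_of_le₀ norm_exp_I_mul_ofReal_sub_one_le (norm_nonneg _)

theorem hasDerivAt_charFun_of_integral_stein {ν : Measure ℝ} [IsProbabilityMeasure ν]
    (hint : Integrable (fun x => x) ν)
    (h : ∀ f : ℝ → ℝ, ContDiff ℝ 1 f → (∃ M : ℝ, ∀ x : ℝ, |deriv f x| ≤ M) →
      ∫ x, (x * deriv f x - f (x + 1) + f x) ∂ν = 0) (t : ℝ) :
    HasDerivAt (charFun ν) (dickmanMultiplier t * charFun ν t) t := by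
  have hmem : MemLp id ((1 : ℕ) : ENNReal) ν := by
    exact_mod_cast memLp_one_iff_integrable.2 hint
  have hd : HasDerivAt (charFun ν) (deriv (charFun ν) t) t :=
    ((contDiff_charFun hmem).differentiable (by simp) t).hasDerivAt
  refine hd.congr_deriv ?_
  have hder := iteratedDeriv_charFun (t := t) hmem
  rw [iteratedDeriv_one] at hder
  rw [hder]
  simp only [pow_one]
  have hE : Integrable (fun x : ℝ => Complex.exp (t * x * Complex.I)) ν := by
    refine (integrable_const (1 : ℝ)).mono' (by fun_prop) (.of_forall fun x => ?_)
    rw [← Complex.ofReal_mul, Complex.norm_exp_ofReal_mul_I]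
  have hxE : Integrable (fun x : ℝ => (x : ℂ) * Complex.exp (t * x * Complex.I)) ν := by
    refine hint.norm.mono' (by fun_prop) (.of_forall fun x => ?_)
    rw [norm_mul, ← Complex.ofReal_mul, Complex.norm_exp_ofReal_mul_I, Complex.norm_real, mul_one]
  by_cases ht : t = 0
  · have := h (fun x => x) contDiff_id ⟨1, fun x => by simp⟩
    have h1 : ∫ x, (x - 1) ∂ν = 0 := by
      rw [← this]
      congr 1 with x
      simp only [deriv_id'']
      ring
    rw [integral_sub hint (integrable_const _)] at h1
    have h2 : ∫ x, x ∂ν = 1 := by simpa [sub_eq_zero] using h1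
    have h3 : ∫ x : ℝ, (x : ℂ) ∂ν = 1 := by rw [integral_complex_ofReal, h2, Complex.ofReal_one]
    simp [ht, dickmanMultiplier, h3]
  have hcos (x : ℝ) : HasDerivAt (fun y => cos (t * y)) (-t * sin (t * x)) x :=
    (((hasDerivAt_id x).const_mul t).cos).congr_deriv (by simp; ring)
  have hsin (x : ℝ) : HasDerivAt (fun y => sin (t * y)) (t * cos (t * x)) x :=
    (((hasDerivAt_id x).const_mul t).sin).congr_deriv (by simp; ring)
  have h1 := h (fun y => cos (t * y)) (by fun_prop) ⟨|t|, fun x => by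
    rw [(hcos x).deriv, abs_mul, abs_neg]
    exact mul_le_of_le_one_right (abs_nonneg _) (abs_sin_le_one _)⟩
  have h2 := h (fun y => sin (t * y)) (by fun_prop) ⟨|t|, fun x => by
    rw [(hsin x).deriv, abs_mul]
    exact mul_le_of_le_one_right (abs_nonneg _) (abs_cos_le_one _)⟩
  simp only [(hcos _).deriv] at h1
  simp only [(hsin _).deriv] at h2
  set G : ℝ → ℂ := fun x => (t * Complex.I) * (x * Complex.exp (t * x * Complex.I))
    - (Complex.exp (Complex.I * t) - 1) * Complex.exp (t * x * Complex.I) with hG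
  have hGint : Integrable G ν := (hxE.const_mul _).sub (hE.const_mul _)
  have hG' (x : ℝ) : G x = (x * (-t * sin (t * x)) - cos (t * (x + 1)) + cos (t * x) : ℝ)
      + (x * (t * cos (t * x)) - sin (t * (x + 1)) + sin (t * x) : ℝ) * Complex.I := by
    have e1 : Complex.exp (Complex.I * t) * Complex.exp (t * x * Complex.I)
        = Complex.exp ((t * (x + 1) : ℝ) * Complex.I) := by
      rw [← Complex.exp_add]; push_cast; ring_nf
    have e2 : Complex.exp (t * x * Complex.I) = Complex.exp ((t * x : ℝ) * Complex.I) := by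
      push_cast; rfl
    simp only [hG, sub_mul, one_mul, e1]
    rw [e2, Complex.exp_mul_I, Complex.exp_mul_I]
    push_cast
    linear_combination (t * x * Complex.sin (t * x)) * Complex.I_sq
  have hG0 : ∫ x, G x ∂ν = 0 := by
    apply Complex.ext
    · rw [← Complex.reCLM_apply, ← Complex.reCLM.integral_comp_comm hGint, Complex.zero_re, ← h1]
      congr 1 with x
      rw [hG', Complex.reCLM_apply]
      simp [-Complex.ofReal_add, -Complex.ofReal_sub, -Complex.ofReal_mul, -Complex.ofReal_neg]
    · rw [← Complex.imCLM_apply, ← Complex.imCLM.integral_comp_comm hGint, Complex.zero_im, ← h2]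
      congr 1 with x
      rw [hG', Complex.imCLM_apply]
      simp [-Complex.ofReal_add, -Complex.ofReal_sub, -Complex.ofReal_mul, -Complex.ofReal_neg]
  rw [hG, integral_sub (hxE.const_mul _) (hE.const_mul _), integral_const_mul,
    integral_const_mul] at hG0
  have ht' : (t : ℂ) ≠ 0 := by exact_mod_cast ht
  rw [charFun_apply_real, dickmanMultiplier, if_neg ht]
  rw [div_mul_eq_mul_div, eq_div_iff ht']
  linear_combination hG0

theorem eq_of_integral_stein {ν₁ ν₂ : Measure ℝ} [IsProbabilityMeasure ν₁] [IsProbabilityMeasure ν₂]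
    (hint₁ : Integrable (fun x => x) ν₁) (hint₂ : Integrable (fun x => x) ν₂)
    (h₁ : ∀ f : ℝ → ℝ, ContDiff ℝ 1 f → (∃ M : ℝ, ∀ x : ℝ, |deriv f x| ≤ M) →
      ∫ x, (x * deriv f x - f (x + 1) + f x) ∂ν₁ = 0)
    (h₂ : ∀ f : ℝ → ℝ, ContDiff ℝ 1 f → (∃ M : ℝ, ∀ x : ℝ, |deriv f x| ≤ M) →
      ∫ x, (x * deriv f x - f (x + 1) + f x) ∂ν₂ = 0) : ν₁ = ν₂ := by
  refine Measure.ext_of_charFun (ODE_solution_unique_univ (K := 1) (s := fun _ => univ) (t₀ := 0)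
    (v := fun t x => dickmanMultiplier t * x) (fun t => ?_)
    (fun t => ⟨hasDerivAt_charFun_of_integral_stein hint₁ h₁ t, mem_univ _⟩)
    (fun t => ⟨hasDerivAt_charFun_of_integral_stein hint₂ h₂ t, mem_univ _⟩) (by simp))
  refine (LipschitzWith.of_dist_le_mul fun x y => ?_).lipschitzOnWith
  rw [dist_eq_norm, dist_eq_norm, ← mul_sub, norm_mul]
  exact mul_le_mul_of_nonneg_right (by simpa using norm_dickmanMultiplier_le t) (norm_nonneg _)

end Uniqueness

theorem isDickman_extension {ρ : ℝ → ℝ} (hρ_cont : ContinuousOn ρ (Set.Ici (0 : ℝ)))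
    (hρ_init : ∀ u : ℝ, 0 ≤ u → u ≤ 1 → ρ u = 1)
    (hρ_delay : ∀ u : ℝ, 1 < u → HasDerivAt ρ (-ρ (u - 1) / u) u) :
    IsDickman fun u => ρ (max u 0) where
  continuous := hρ_cont.comp_continuous (by fun_prop) fun u => le_max_right u 0
  eq_one u hu := hρ_init _ (le_max_right u 0) (max_le hu zero_le_one)
  hasDerivAt u hu := by
    rw [max_eq_left (by linarith)]
    refine (hρ_delay u hu).congr_of_eventuallyEq ?_
    filter_upwards [lt_mem_nhds hu] with x hx
    rw [max_eq_left (by linarith)]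


/-- A nonnegative integrable random variable `W` follows the Dickman law (density
`x ↦ e^{−γ} ρ(x)` on `[0,∞)`, `ρ` the Dickman function) if and only if for every continuously
differentiable `f : ℝ → ℝ` with bounded derivative, `E[W f′(W) − f(W+1) + f(W)] = 0`. -/
theorem dickman_stein_characterization
    (ρ : ℝ → ℝ)
    (hρ_cont : ContinuousOn ρ (Set.Ici (0 : ℝ)))
    (hρ_init : ∀ u : ℝ, 0 ≤ u → u ≤ 1 → ρ u = 1)
    (hρ_delay : ∀ u : ℝ, 1 < u → HasDerivAt ρ (-ρ (u - 1) / u) u)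
    (Ω : Type*) [MeasurableSpace Ω] (μ : Measure Ω) [IsProbabilityMeasure μ]
    (W : Ω → ℝ) (hW : Measurable W) (hW_nonneg : ∀ ω, 0 ≤ W ω)
    (hW_int : Integrable W μ) :
    (Measure.map W μ =
        (volume.restrict (Set.Ici (0 : ℝ))).withDensity
          (fun x => ENNReal.ofReal (Real.exp (-Real.eulerMascheroniConstant) * ρ x)))
      ↔ ∀ f : ℝ → ℝ, ContDiff ℝ 1 f → (∃ M : ℝ, ∀ x : ℝ, |deriv f x| ≤ M) →
          ∫ ω, (W ω * deriv f (W ω) - f (W ω + 1) + f (W ω)) ∂μ = 0 := by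
  set r : ℝ → ℝ := fun u => ρ (max u 0)
  have hr : IsDickman r := isDickman_extension hρ_cont hρ_init hρ_delay
  have hc : 0 ≤ exp (-eulerMascheroniConstant) := (exp_pos _).le
  have hmeas : (volume.restrict (Set.Ici (0 : ℝ))).withDensity
      (fun x => ENNReal.ofReal (exp (-eulerMascheroniConstant) * ρ x))
      = IsDickman.measure r (exp (-eulerMascheroniConstant)) := by
    rw [IsDickman.measure, ← Measure.restrict_congr_set (Ioi_ae_eq_Ici (a := (0 : ℝ)))]
    refine withDensity_congr_ae ((ae_restrict_iff' measurableSet_Ioi).2 (.of_forall fun x hx => ?_))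
    simp only [r, max_eq_left (le_of_lt (Set.mem_Ioi.1 hx))]
  have hmap {f : ℝ → ℝ} (hf : ContDiff ℝ 1 f) :
      ∫ x, (x * deriv f x - f (x + 1) + f x) ∂(Measure.map W μ)
        = ∫ ω, (W ω * deriv f (W ω) - f (W ω + 1) + f (W ω)) ∂μ := by
    have h1 := hf.continuous
    have h2 := hf.continuous_deriv le_rfl
    exact integral_map hW.aemeasurable (by fun_prop : Continuous _).aestronglyMeasurable
  rw [hmeas]
  constructor
  · intro h f hf hM
    rw [← hmap hf, h]
    exact hr.integral_stein_measure hc hf hM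
  · intro h
    have := Measure.isProbabilityMeasure_map (μ := μ) hW.aemeasurable
    have := hr.isProbabilityMeasure_measure
    refine eq_of_integral_stein ?_ (hr.integrable_id_measure hc)
      (fun f hf hM => (hmap hf).trans (h f hf hM)) fun f hf hM => hr.integral_stein_measure hc hf hM
    exact (integrable_map_measure (by fun_prop) hW.aemeasurable).2 hW_int
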